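/- arXiv:1612.08123 — 3 statements merged into one kernel-verified Lean document; each statement's English description precedes it below -/
import Mathlib

section
/- Every element a of the root lattice A_8 = {a in Z^9 : a_1+...+a_9 = 0} can be written as a = b + 2c with b, c in A_8 and every coordinate of b belonging to {-1,0,1}. Consequently, every coset of the subgroup 2A_8 in A_8 contains a vector of norm <a,a> at most 8, and the minimal norm of every coset lies in {0,2,4,6,8}. -/
/-- An integer vector with zero sum is congruent modulo `2` to a zero-sum vector with all
coordinates in `{-1, 0, 1}`. -/
theorem exists_sign_vector_modEq_two {ι : Type*} [Fintype ι] (a : ι → ℤ)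
    (ha : ∑ i, a i = 0) :
    ∃ b c : ι → ℤ, (∑ i, b i = 0) ∧ (∑ i, c i = 0) ∧
      (∀ i, a i = b i + 2 * c i) ∧ (∀ i, b i = -1 ∨ b i = 0 ∨ b i = 1) := by
  classical
  let s : Finset ι := {i | Odd (a i)}
  have hs : ∀ i, i ∈ s ↔ Odd (a i) := fun i => by simp [s]
  have hcard : (2 : ℤ) ∣ s.card := by
    have h : (2 : ℤ) ∣ ∑ i, (a i - if i ∈ s then 1 else 0) := by
      refine Finset.dvd_sum fun i _ => ?_
      by_cases hi : i ∈ s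
      · have := (hs i).1 hi
        grind
      · have := (hs i).not.1 hi
        grind
    simpa [Finset.sum_sub_distrib, ha] using h
  obtain ⟨t, hts, ht⟩ := Finset.exists_subset_card_eq (Nat.div_le_self s.card 2)
  let b : ι → ℤ := fun i => 2 * (if i ∈ t then 1 else 0) - if i ∈ s then 1 else 0
  have hb : ∑ i, b i = 0 := by
    simp only [b, Finset.sum_sub_distrib, ← Finset.mul_sum, Finset.sum_boole,
      Finset.filter_univ_mem, ht]
    push_cast
    lia
  have hc : ∀ i, ∃ k, a i = b i + 2 * k := fun i => by
    by_cases hi : i ∈ s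
    · obtain ⟨k, hk⟩ := (hs i).1 hi
      exact ⟨k + 1 - if i ∈ t then 1 else 0, by simp only [b, hi, if_true]; lia⟩
    · obtain ⟨k, hk⟩ := Int.not_odd_iff_even.1 ((hs i).not.1 hi)
      exact ⟨k - if i ∈ t then 1 else 0, by simp only [b, hi, if_false]; lia⟩
  choose c hc using hc
  refine ⟨b, c, hb, ?_, hc, fun i => ?_⟩
  · simp only [hc, Finset.sum_add_distrib, ← Finset.mul_sum, hb] at ha
    lia
  · have := @hts i
    grind

/-- A vector with coordinates in `{-1, 0, 1}` has minimal norm in its class modulo `2`. -/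
theorem sum_mul_self_le_of_modEq_two {ι : Type*} [Fintype ι] {b b' : ι → ℤ}
    (hb : ∀ i, b i = -1 ∨ b i = 0 ∨ b i = 1) (h : ∀ i, (2 : ℤ) ∣ b' i - b i) :
    ∑ i, b i * b i ≤ ∑ i, b' i * b' i := by
  refine Finset.sum_le_sum fun i _ => ?_
  obtain ⟨k, hk⟩ := h i
  rcases eq_or_ne (b' i) 0 with h0 | h0
  · have : b i = 0 := by have := hb i; lia
    simp [this, h0]
  · have : 0 < b' i * b' i := mul_self_pos.2 h0
    rcases hb i with h1 | h1 | h1 <;> rw [h1] <;> lia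

/-- The norm of a zero-sum integer vector is even. -/
theorem two_dvd_sum_mul_self {ι : Type*} [Fintype ι] {b : ι → ℤ} (hb : ∑ i, b i = 0) :
    (2 : ℤ) ∣ ∑ i, b i * b i := by
  have h : (2 : ℤ) ∣ ∑ i, (b i * b i - b i) :=
    Finset.dvd_sum fun i _ => by
      simpa [mul_sub] using (Int.even_mul_pred_self (b i)).two_dvd
  simpa [Finset.sum_sub_distrib, hb] using h


/-- Every element `a` of the root lattice `A₈ = {a ∈ ℤ⁹ : a₁ + ⋯ + a₉ = 0}` can be written
as `a = b + 2c` with `b, c ∈ A₈` and all coordinates of `b` in `{-1, 0, 1}`; consequently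
the coset `a + 2A₈` contains a vector of norm at most `8`, and its minimal norm lies in
`{0, 2, 4, 6, 8}`. -/
theorem A8_coset_contains_short_vector (a : Fin 9 → ℤ) (ha : ∑ i, a i = 0) :
    (∃ b c : Fin 9 → ℤ, (∑ i, b i = 0) ∧ (∑ i, c i = 0) ∧
      (∀ i, a i = b i + 2 * c i) ∧ (∀ i, b i = -1 ∨ b i = 0 ∨ b i = 1)) ∧
    (∃ b : Fin 9 → ℤ, (∑ i, b i = 0) ∧
      (∃ c : Fin 9 → ℤ, (∑ i, c i = 0) ∧ ∀ i, a i = b i + 2 * c i) ∧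
      (∑ i, b i * b i) ≤ 8 ∧
      (∑ i, b i * b i) ∈ ({0, 2, 4, 6, 8} : Set ℤ) ∧
      (∀ b' : Fin 9 → ℤ, (∑ i, b' i = 0) →
        (∃ c : Fin 9 → ℤ, (∑ i, c i = 0) ∧ ∀ i, a i = b' i + 2 * c i) →
        (∑ i, b i * b i) ≤ (∑ i, b' i * b' i))) := by
  obtain ⟨b, c, hb, hc, habc, hval⟩ := exists_sign_vector_modEq_two a ha
  have hle : ∑ i, b i * b i ≤ 9 := by
    have : ∑ i, b i * b i ≤ ∑ _i : Fin 9, (1 : ℤ) :=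
      Finset.sum_le_sum fun i _ => by rcases hval i with h | h | h <;> simp [h]
    simpa using this
  have hnonneg : 0 ≤ ∑ i, b i * b i := Finset.sum_nonneg fun i _ => mul_self_nonneg _
  have heven := two_dvd_sum_mul_self hb
  refine ⟨⟨b, c, hb, hc, habc, hval⟩, b, hb, ⟨c, hc, habc⟩, by lia, ?_, ?_⟩
  · simp only [Set.mem_insert_iff, Set.mem_singleton_iff]
    lia
  · rintro b' - ⟨c', -, h'⟩
    refine sum_mul_self_le_of_modEq_two hval fun i => ⟨c i - c' i, ?_⟩
    have := habc i
    have := h' i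
    lia
end

section
/- The quotient group A_8/2A_8 has exactly 2^8 = 256 elements. The number of cosets of 2A_8 in A_8 whose minimal norm equals 0, 2, 4, 6 is 1, 36, 126, 84, respectively, and every remaining coset has minimal norm 8. Moreover, for 1 <= n <= 4, every coset of minimal norm 2n contains a vector having exactly n coordinates equal to 1, exactly n coordinates equal to -1, and all other coordinates 0. -/
/-- The root lattice `A₈ = {a ∈ ℤ⁹ : a₁ + ⋯ + a₉ = 0}` as an additive subgroup of `ℤ⁹`. -/
def A8lat : AddSubgroup (Fin 9 → ℤ) where
  carrier := {a | ∑ i, a i = 0}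
  add_mem' := by
    intro a b ha hb
    simp only [Set.mem_setOf_eq, Pi.add_apply, Finset.sum_add_distrib] at *
    simp [ha, hb]
  zero_mem' := by simp
  neg_mem' := by
    intro a ha
    simp only [Set.mem_setOf_eq, Pi.neg_apply, Finset.sum_neg_distrib] at *
    simp [ha]

/-- The subgroup `2A₈ = {2a : a ∈ A₈}` of `A₈`. -/
def twoA8sub : AddSubgroup A8lat where
  carrier := {a | ∃ b : A8lat, a = 2 • b}
  add_mem' := by
    rintro a b ⟨x, rfl⟩ ⟨y, rfl⟩
    exact ⟨x + y, by rw [smul_add]⟩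
  zero_mem' := ⟨0, by simp⟩
  neg_mem' := by
    rintro a ⟨x, rfl⟩
    exact ⟨-x, by simp⟩

/-- The squared norm `⟨a, a⟩` of a lattice vector, as a natural number. -/
def normA8 (a : A8lat) : ℕ := (∑ i, (a : Fin 9 → ℤ) i * (a : Fin 9 → ℤ) i).toNat

/-- The minimal norm of a coset in `A₈/2A₈`. -/
noncomputable def minNormCoset (q : A8lat ⧸ twoA8sub) : ℕ :=
  sInf {k : ℕ | ∃ a : A8lat, (QuotientAddGroup.mk a : A8lat ⧸ twoA8sub) = q ∧ normA8 a = k}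

/-- The set of coordinates at which a vector of `A₈` is odd. -/
def oddSupport (a : A8lat) : Finset (Fin 9) :=
  Finset.univ.filter fun i => Odd ((a : Fin 9 → ℤ) i)

lemma mem_oddSupport {a : A8lat} {i : Fin 9} :
    i ∈ oddSupport a ↔ Odd ((a : Fin 9 → ℤ) i) := by
  simp [oddSupport]

lemma card_oddSupport_eq_sum (a : A8lat) :
    ((oddSupport a).card : ℤ) = ∑ i, if Odd ((a : Fin 9 → ℤ) i) then 1 else 0 := by
  simp [oddSupport]

lemma even_card_oddSupport (a : A8lat) : Even (oddSupport a).card := by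
  have h : ∑ i, (a : Fin 9 → ℤ) i = 0 := a.2
  have key : (((oddSupport a).card : ℤ) : ZMod 2) = ((∑ i, (a : Fin 9 → ℤ) i : ℤ) : ZMod 2) := by
    rw [card_oddSupport_eq_sum]
    push_cast
    refine Finset.sum_congr rfl fun i _ => ?_
    split_ifs with hi
    · exact (ZMod.intCast_eq_one_iff_odd.2 hi).symm
    · exact (ZMod.intCast_eq_zero_iff_even.2 (Int.not_odd_iff_even.1 hi)).symm
  rw [h, Int.cast_zero, Int.cast_natCast] at key
  exact ZMod.natCast_eq_zero_iff_even.1 key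

lemma mk_eq_mk_iff_oddSupport_eq (a b : A8lat) :
    (QuotientAddGroup.mk a : A8lat ⧸ twoA8sub) = QuotientAddGroup.mk b ↔
      oddSupport a = oddSupport b := by
  rw [QuotientAddGroup.eq, Finset.ext_iff]
  simp only [mem_oddSupport]
  constructor
  · rintro ⟨c, hc⟩ i
    have h := congrFun (congrArg Subtype.val hc) i
    simp only [AddSubgroup.coe_add, AddSubgroup.coe_neg, AddSubgroup.coe_nsmul, Pi.add_apply,
      Pi.neg_apply, Pi.smul_apply, nsmul_eq_mul, Nat.cast_ofNat] at h
    grind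
  · intro h
    have hdiv : ∀ i, ∃ c : ℤ, -(a : Fin 9 → ℤ) i + (b : Fin 9 → ℤ) i = 2 * c := by
      intro i
      refine even_iff_two_dvd.1 ?_
      rw [Int.even_add, even_neg, ← not_iff_not, Int.not_even_iff_odd, Int.not_even_iff_odd]
      exact h i
    choose c hc using hdiv
    have ha : ∑ i, (a : Fin 9 → ℤ) i = 0 := a.2
    have hb : ∑ i, (b : Fin 9 → ℤ) i = 0 := b.2
    have hsum : ∑ i, c i = 0 := by
      have h2 := Finset.sum_congr (rfl : (Finset.univ : Finset (Fin 9)) = _) fun i _ => hc i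
      rw [Finset.sum_add_distrib, Finset.sum_neg_distrib, ← Finset.mul_sum, ha, hb] at h2
      lia
    refine ⟨⟨c, hsum⟩, Subtype.ext (funext fun i => ?_)⟩
    simpa using hc i

lemma card_oddSupport_le_normA8 (a : A8lat) : (oddSupport a).card ≤ normA8 a := by
  rw [normA8, Int.le_toNat (Finset.sum_nonneg fun i _ => mul_self_nonneg _),
    card_oddSupport_eq_sum]
  refine Finset.sum_le_sum fun i _ => ?_
  split_ifs with h
  · have : (a : Fin 9 → ℤ) i ≠ 0 := by
      intro h0
      simp [h0] at h
    have := mul_self_pos.2 this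
    lia
  · exact mul_self_nonneg _

lemma normA8_eq_card_oddSupport (a : A8lat)
    (h : ∀ i, (a : Fin 9 → ℤ) i = 1 ∨ (a : Fin 9 → ℤ) i = -1 ∨ (a : Fin 9 → ℤ) i = 0) :
    normA8 a = (oddSupport a).card := by
  rw [normA8, ← Int.toNat_natCast (oddSupport a).card, card_oddSupport_eq_sum]
  congr 1
  refine Finset.sum_congr rfl fun i _ => ?_
  rcases h i with h | h | h <;> simp [h]

lemma exists_signs_of_card_eq {s : Finset (Fin 9)} {n : ℕ} (hs : s.card = 2 * n) :
    ∃ a : A8lat, oddSupport a = s ∧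
      (Finset.univ.filter (fun i => (a : Fin 9 → ℤ) i = 1)).card = n ∧
      (Finset.univ.filter (fun i => (a : Fin 9 → ℤ) i = -1)).card = n ∧
      (∀ i, (a : Fin 9 → ℤ) i = 1 ∨ (a : Fin 9 → ℤ) i = -1 ∨ (a : Fin 9 → ℤ) i = 0) := by
  obtain ⟨t, hts, ht⟩ := Finset.exists_subset_card_eq (show n ≤ s.card by lia)
  have hst : (s \ t).card = n := by
    rw [Finset.card_sdiff_of_subset hts]
    lia
  let f : Fin 9 → ℤ := fun i => (if i ∈ t then 1 else 0) - if i ∈ s \ t then 1 else 0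
  have hf : ∑ i, f i = 0 := by
    simp only [f, Finset.sum_sub_distrib, Finset.sum_boole, Finset.filter_univ_mem, ht, hst,
      sub_self]
  have hsub : ∀ i, i ∈ t → i ∈ s := fun i hi => hts hi
  refine ⟨⟨f, hf⟩, ?_, ?_, ?_, fun i => ?_⟩
  · ext i
    have := hsub i
    by_cases h1 : i ∈ t <;> by_cases h2 : i ∈ s <;> simp_all [mem_oddSupport, f]
  · rw [← ht]
    congr 1
    ext i
    by_cases h1 : i ∈ t <;> by_cases h2 : i ∈ s <;> simp_all [f]
  · rw [← hst]
    congr 1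
    ext i
    have := hsub i
    by_cases h1 : i ∈ t <;> by_cases h2 : i ∈ s <;> simp_all [f]
  · have := hsub i
    by_cases h1 : i ∈ t <;> by_cases h2 : i ∈ s <;> simp_all [f]

lemma minNormCoset_mk (a : A8lat) :
    minNormCoset (QuotientAddGroup.mk a) = (oddSupport a).card := by
  obtain ⟨n, hn⟩ := (even_card_oddSupport a).two_dvd
  obtain ⟨b, hb, -, -, hsigns⟩ := exists_signs_of_card_eq hn
  refine le_antisymm (Nat.sInf_le ⟨b, (mk_eq_mk_iff_oddSupport_eq b a).2 hb, ?_⟩) ?_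
  · rw [normA8_eq_card_oddSupport b hsigns, hb]
  · refine le_csInf ⟨_, a, rfl, rfl⟩ ?_
    rintro k ⟨c, hc, rfl⟩
    rw [← (mk_eq_mk_iff_oddSupport_eq c a).1 hc]
    exact card_oddSupport_le_normA8 c

/-- The odd support of the vectors in a coset of `2A₈`. -/
def cosetOddSupport (q : A8lat ⧸ twoA8sub) : {s : Finset (Fin 9) // Even s.card} :=
  Quotient.lift (fun a => ⟨oddSupport a, even_card_oddSupport a⟩)
    (fun a b h => Subtype.ext ((mk_eq_mk_iff_oddSupport_eq a b).1 (Quotient.sound h))) q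

lemma cosetOddSupport_bijective : Function.Bijective cosetOddSupport := by
  constructor
  · intro p q h
    induction p using QuotientAddGroup.induction_on with | H a => ?_
    induction q using QuotientAddGroup.induction_on with | H b => ?_
    exact (mk_eq_mk_iff_oddSupport_eq a b).2 (congrArg Subtype.val h)
  · rintro ⟨s, hs⟩
    obtain ⟨n, hn⟩ := hs.two_dvd
    obtain ⟨a, ha, -⟩ := exists_signs_of_card_eq hn
    exact ⟨QuotientAddGroup.mk a, Subtype.ext ha⟩

lemma minNormCoset_eq_card (q : A8lat ⧸ twoA8sub) :
    minNormCoset q = (cosetOddSupport q : Finset (Fin 9)).card := by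
  induction q using QuotientAddGroup.induction_on with | H a => ?_
  exact minNormCoset_mk a

lemma card_minNormCoset_eq {k : ℕ} (hk : Even k) :
    Nat.card {q : A8lat ⧸ twoA8sub // minNormCoset q = k} = Nat.choose 9 k := by
  have e : {q : A8lat ⧸ twoA8sub // minNormCoset q = k} ≃ {s : Finset (Fin 9) // s.card = k} :=
    ((Equiv.ofBijective _ cosetOddSupport_bijective).subtypeEquiv
      (q := fun s : {s : Finset (Fin 9) // Even s.card} => (s : Finset (Fin 9)).card = k)
      fun q => by rw [minNormCoset_eq_card]; rfl).trans
    (Equiv.subtypeSubtypeEquivSubtype (p := fun s : Finset (Fin 9) => Even s.card)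
      (q := fun s => s.card = k) fun {s} h => show Even s.card from h ▸ hk)
  rw [Nat.card_congr e, Nat.card_eq_fintype_card, Fintype.card_finset_len, Fintype.card_fin]

theorem A8_mod_two_A8_coset_counts :
    Nat.card (A8lat ⧸ twoA8sub) = 256 ∧
    Nat.card {q : A8lat ⧸ twoA8sub // minNormCoset q = 0} = 1 ∧
    Nat.card {q : A8lat ⧸ twoA8sub // minNormCoset q = 2} = 36 ∧
    Nat.card {q : A8lat ⧸ twoA8sub // minNormCoset q = 4} = 126 ∧
    Nat.card {q : A8lat ⧸ twoA8sub // minNormCoset q = 6} = 84 ∧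
    (∀ q : A8lat ⧸ twoA8sub,
      minNormCoset q ≠ 0 → minNormCoset q ≠ 2 → minNormCoset q ≠ 4 → minNormCoset q ≠ 6 →
      minNormCoset q = 8) ∧
    (∀ n : ℕ, 1 ≤ n → n ≤ 4 → ∀ q : A8lat ⧸ twoA8sub, minNormCoset q = 2 * n →
      ∃ a : A8lat, (QuotientAddGroup.mk a : A8lat ⧸ twoA8sub) = q ∧
        (Finset.univ.filter (fun i => (a : Fin 9 → ℤ) i = 1)).card = n ∧
        (Finset.univ.filter (fun i => (a : Fin 9 → ℤ) i = -1)).card = n ∧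
        (∀ i, (a : Fin 9 → ℤ) i = 1 ∨ (a : Fin 9 → ℤ) i = -1 ∨ (a : Fin 9 → ℤ) i = 0)) := by
  refine ⟨?_, card_minNormCoset_eq (by decide), card_minNormCoset_eq (by decide),
    card_minNormCoset_eq (by decide), card_minNormCoset_eq (by decide), fun q h0 h2 h4 h6 => ?_,
    fun n _ _ q hq => ?_⟩
  · rw [Nat.card_congr (Equiv.ofBijective _ cosetOddSupport_bijective), Nat.card_eq_fintype_card]
    rw [Fintype.card_subtype, Finset.card_filter, ← Finset.powerset_univ,
      Finset.sum_powerset_apply_card (fun k => if Even k then 1 else 0), Finset.card_fin]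
    decide
  · rw [minNormCoset_eq_card] at *
    have hle := Finset.card_le_univ (cosetOddSupport q : Finset (Fin 9))
    rw [Fintype.card_fin] at hle
    have := (cosetOddSupport q).2
    grind
  · rw [minNormCoset_eq_card] at hq
    obtain ⟨a, ha, h⟩ := exists_signs_of_card_eq hq
    exact ⟨a, cosetOddSupport_bijective.1 (Subtype.ext ha), h⟩
end

section
/- There exist subgroups X and Y of A_8 with 2A_8 contained in both X and Y such that: X/2A_8 and Y/2A_8 are 4-dimensional totally singular F_2-subspaces of the quadratic space (A_8/2A_8, q) (i.e., q vanishes identically on each of them, and 4 is the maximal possible dimension of a totally singular subspace), and X + Y = A_8; equivalently, A_8/2A_8 is the direct sum of the two maximal totally singular subspaces X/2A_8 and Y/2A_8. -/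
/-- The sublattice `2A₈ = {2c : c ∈ A₈}` as an additive subgroup of `ℤ⁹`. -/
def twoA8lat : AddSubgroup (Fin 9 → ℤ) where
  carrier := {a | ∃ c : Fin 9 → ℤ, (∑ i, c i = 0) ∧ ∀ i, a i = 2 * c i}
  zero_mem' := ⟨0, by simp, fun i => by simp⟩
  add_mem' := by
    rintro a b ⟨c, hc, hac⟩ ⟨d, hd, hbd⟩
    refine ⟨c + d, by simp [Finset.sum_add_distrib, hc, hd], fun i => ?_⟩
    simp only [Pi.add_apply, hac i, hbd i]
    ring
  neg_mem' := by
    rintro a ⟨c, hc, hac⟩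
    refine ⟨-c, by simp [Finset.sum_neg_distrib, hc], fun i => ?_⟩
    simp only [Pi.neg_apply, hac i]
    ring

open Matrix Module

/-- Reduction modulo two of integer vectors. -/
def modTwo : (Fin 9 → ℤ) →+ (Fin 9 → ZMod 2) :=
  (Int.castAddHom (ZMod 2)).compLeft (Fin 9)

lemma modTwo_apply (a : Fin 9 → ℤ) (i : Fin 9) : modTwo a i = (a i : ZMod 2) := rfl

lemma mem_A8lat {a : Fin 9 → ℤ} : a ∈ A8lat ↔ ∑ i, a i = 0 := Iff.rfl

lemma mem_twoA8lat_iff {a : Fin 9 → ℤ} : a ∈ twoA8lat ↔ a ∈ A8lat ∧ modTwo a = 0 := by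
  constructor
  · rintro ⟨c, hc, hac⟩
    refine ⟨?_, ?_⟩
    · rw [mem_A8lat]
      simp only [hac, ← Finset.mul_sum, hc, mul_zero]
    · ext i
      rw [modTwo_apply, hac i, Pi.zero_apply]
      exact (ZMod.intCast_zmod_eq_zero_iff_dvd _ 2).2 ⟨_, rfl⟩
  · rintro ⟨ha, h⟩
    have hdvd (i : Fin 9) : ∃ c, a i = 2 * c :=
      (ZMod.intCast_zmod_eq_zero_iff_dvd _ 2).1 (congrFun h i)
    choose c hc using hdvd
    refine ⟨c, ?_, hc⟩
    rw [mem_A8lat] at ha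
    simp only [hc, ← Finset.mul_sum] at ha
    omega

/-- Every vector of even weight is the reduction of a vector of the root lattice. -/
lemma exists_mem_A8lat_modTwo_eq {v : Fin 9 → ZMod 2} (hv : ∑ i, v i = 0) :
    ∃ a ∈ A8lat, modTwo a = v := by
  have hsum : ((∑ i, ((v i).val : ℤ) : ℤ) : ZMod 2) = 0 := by
    simpa using hv
  obtain ⟨k, hk⟩ := (ZMod.intCast_zmod_eq_zero_iff_dvd _ 2).1 hsum
  have h2 : (2 : ZMod 2) = 0 := rfl
  refine ⟨(fun i => ((v i).val : ℤ)) - Pi.single 0 (2 * k), ?_, ?_⟩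
  · rw [mem_A8lat]
    simp only [Pi.sub_apply, Finset.sum_sub_distrib, hk]
    simp
  · ext i
    rw [modTwo_apply]
    by_cases hi : i = 0
    · subst hi
      simp [h2]
    · simp [Pi.single_eq_of_ne hi]

lemma sum_modTwo_eq_zero {a : Fin 9 → ℤ} (ha : a ∈ A8lat) : ∑ i, modTwo a i = 0 := by
  simp only [modTwo_apply]
  rw [← Int.cast_sum, mem_A8lat.1 ha, Int.cast_zero]

/-- The norm of an integer vector is, modulo four, its number of odd coordinates. -/
lemma four_dvd_sum_mul_self_iff (a : Fin 9 → ℤ) :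
    (4 : ℤ) ∣ ∑ i, a i * a i ↔ 4 ∣ ∑ i, (modTwo a i).val := by
  have hsq (n : ℤ) : (4 : ℤ) ∣ n * n - ((n : ZMod 2).val : ℤ) := by
    rw [ZMod.val_intCast]
    obtain ⟨k, rfl | rfl⟩ := n.even_or_odd'
    · exact ⟨k * k, by push_cast; rw [Int.mul_emod_right]; ring⟩
    · refine ⟨k * k + k, ?_⟩
      have : (2 * k + 1) % ((2 : ℕ) : ℤ) = 1 := by push_cast; omega
      rw [this]; ring
  have hsub : (4 : ℤ) ∣ ∑ i, a i * a i - ((∑ i, (modTwo a i).val : ℕ) : ℤ) := by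
    push_cast
    rw [← Finset.sum_sub_distrib]
    exact Finset.dvd_sum fun i _ => hsq (a i)
  rw [(dvd_iff_dvd_of_dvd_sub hsub)]
  omega

lemma card_quotient_twoA8lat {Z : AddSubgroup (Fin 9 → ℤ)} (hZ : Z ≤ A8lat) :
    Nat.card (↥Z ⧸ twoA8lat.addSubgroupOf Z) = Nat.card (Z.map modTwo) := by
  have hker : twoA8lat.addSubgroupOf Z = (modTwo.comp Z.subtype).ker := by
    ext a
    rw [AddSubgroup.mem_addSubgroupOf, mem_twoA8lat_iff]
    exact and_iff_right (hZ a.2)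
  rw [hker, Nat.card_congr (QuotientAddGroup.quotientKerEquivRange _).toEquiv,
    AddMonoidHom.range_comp, AddSubgroup.range_subtype]

/-- A self-orthogonal binary code of length nine has at most sixteen elements. -/
lemma card_le_of_dotProduct_eq_zero (C : Submodule (ZMod 2) (Fin 9 → ZMod 2))
    (hC : ∀ u ∈ C, ∀ v ∈ C, u ⬝ᵥ v = 0) : Nat.card C ≤ 16 := by
  let B : LinearMap.BilinForm (ZMod 2) (Fin 9 → ZMod 2) := dotProductBilin (ZMod 2) (ZMod 2)
  have hB : B.Nondegenerate := ⟨dotProduct_eq_zero, fun v h =>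
    dotProduct_eq_zero v fun u => by rw [dotProduct_comm]; exact h u⟩
  have hle : C ≤ B.orthogonal C := fun v hv u hu => hC u hu v hv
  have hfin := LinearMap.BilinForm.finrank_orthogonal hB C
  have hmono := Submodule.finrank_mono hle
  rw [finrank_fin_fun] at hfin
  have hdim : finrank (ZMod 2) C ≤ 4 := by omega
  rw [Module.natCard_eq_pow_finrank (K := ZMod 2), Nat.card_zmod]
  exact Nat.pow_le_pow_right two_pos hdim

lemma card_quotient_le_of_four_dvd {Z : AddSubgroup (Fin 9 → ℤ)} (hZ : Z ≤ A8lat)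
    (h : ∀ a ∈ Z, (4 : ℤ) ∣ ∑ i, a i * a i) :
    Nat.card (↥Z ⧸ twoA8lat.addSubgroupOf Z) ≤ 16 := by
  rw [card_quotient_twoA8lat hZ]
  refine card_le_of_dotProduct_eq_zero (AddSubgroup.toZModSubmodule 2 (Z.map modTwo)) ?_
  rintro _ ⟨a, ha, rfl⟩ _ ⟨b, hb, rfl⟩
  have hab : (2 : ℤ) ∣ ∑ i, a i * b i := by
    have hexp : ∑ i, (a + b) i * (a + b) i =
        ∑ i, a i * a i + ∑ i, b i * b i + 2 * ∑ i, a i * b i := by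
      simp only [Finset.mul_sum, ← Finset.sum_add_distrib, Pi.add_apply]
      exact Finset.sum_congr rfl fun i _ => by ring
    have := h a ha
    have := h b hb
    have := h (a + b) (add_mem ha hb)
    omega
  have := (ZMod.intCast_zmod_eq_zero_iff_dvd _ 2).2 hab
  simpa [dotProduct, modTwo_apply] using this

/-- The sublattice of the root lattice of vectors whose reduction is in the column space of `M`. -/
def columnLattice (M : Matrix (Fin 9) (Fin 4) (ZMod 2)) : AddSubgroup (Fin 9 → ℤ) :=
  A8lat ⊓ M.mulVecLin.range.toAddSubgroup.comap modTwo

lemma mem_columnLattice {M : Matrix (Fin 9) (Fin 4) (ZMod 2)} {a : Fin 9 → ℤ} :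
    a ∈ columnLattice M ↔ a ∈ A8lat ∧ ∃ u, M *ᵥ u = modTwo a := Iff.rfl

lemma columnLattice_le (M : Matrix (Fin 9) (Fin 4) (ZMod 2)) : columnLattice M ≤ A8lat :=
  inf_le_left

lemma twoA8lat_le_columnLattice (M : Matrix (Fin 9) (Fin 4) (ZMod 2)) :
    twoA8lat ≤ columnLattice M := fun a ha => by
  obtain ⟨ha, h⟩ := mem_twoA8lat_iff.1 ha
  exact mem_columnLattice.2 ⟨ha, 0, by rw [mulVec_zero, h]⟩

lemma four_dvd_of_mem_columnLattice {M : Matrix (Fin 9) (Fin 4) (ZMod 2)}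
    (hM : ∀ u, 4 ∣ ∑ i, ((M *ᵥ u) i).val) {a : Fin 9 → ℤ} (ha : a ∈ columnLattice M) :
    (4 : ℤ) ∣ ∑ i, a i * a i := by
  obtain ⟨-, u, hu⟩ := ha
  rw [four_dvd_sum_mul_self_iff, ← hu]
  exact hM u

lemma sum_mulVec_eq_zero {M : Matrix (Fin 9) (Fin 4) (ZMod 2)}
    (hM : ∀ u, 4 ∣ ∑ i, ((M *ᵥ u) i).val) (u : Fin 4 → ZMod 2) : ∑ i, (M *ᵥ u) i = 0 := by
  have h : ((∑ i, ((M *ᵥ u) i).val : ℕ) : ZMod 2) = 0 :=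
    (ZMod.natCast_eq_zero_iff _ 2).2 (dvd_trans ⟨2, rfl⟩ (hM u))
  simpa using h

lemma card_quotient_columnLattice {M : Matrix (Fin 9) (Fin 4) (ZMod 2)}
    (hM : ∀ u, 4 ∣ ∑ i, ((M *ᵥ u) i).val) (hinj : Function.Injective M.mulVec) :
    Nat.card (↥(columnLattice M) ⧸ twoA8lat.addSubgroupOf (columnLattice M)) = 16 := by
  have hmap : (columnLattice M).map modTwo = M.mulVecLin.range.toAddSubgroup := by
    ext v
    constructor
    · rintro ⟨a, ha, rfl⟩
      exact ha.2
    · rintro ⟨u, rfl⟩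
      obtain ⟨a, ha, h⟩ := exists_mem_A8lat_modTwo_eq (sum_mulVec_eq_zero hM u)
      exact ⟨a, ⟨ha, u, h.symm⟩, h⟩
  rw [card_quotient_twoA8lat (columnLattice_le M), hmap]
  calc Nat.card M.mulVecLin.range = Nat.card (Fin 4 → ZMod 2) :=
        (Nat.card_congr (LinearEquiv.ofInjective M.mulVecLin hinj).toEquiv).symm
    _ = 16 := by simp

/-- Generator matrix of the extended Hamming code on the first eight coordinates. -/
def hammingGen : Matrix (Fin 9) (Fin 4) (ZMod 2) :=
  !![1, 0, 0, 0; 0, 1, 0, 0; 0, 0, 1, 0; 0, 0, 0, 1; 0, 1, 1, 1; 1, 0, 1, 1; 1, 1, 0, 1;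
    1, 1, 1, 0; 0, 0, 0, 0]

/-- Generator matrix of an extended Hamming code on the coordinates other than the fourth. -/
def hammingGen' : Matrix (Fin 9) (Fin 4) (ZMod 2) :=
  !![1, 0, 0, 0; 0, 1, 0, 0; 0, 0, 1, 0; 0, 0, 0, 0; 0, 0, 0, 1; 0, 1, 1, 1; 1, 1, 0, 1;
    1, 0, 1, 1; 1, 1, 1, 0]

/-- The coordinates along `hammingGen` in the sum of the two codes. -/
def hammingDec : Matrix (Fin 4) (Fin 9) (ZMod 2) :=
  !![1, 1, 0, 1, 0, 1, 0, 1, 0; 0, 1, 1, 1, 0, 0, 1, 1, 0; 1, 0, 1, 1, 1, 0, 0, 1, 0;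
    0, 0, 0, 1, 0, 0, 0, 0, 0]

/-- The coordinates along `hammingGen'` in the sum of the two codes. -/
def hammingDec' : Matrix (Fin 4) (Fin 9) (ZMod 2) :=
  !![0, 1, 0, 1, 0, 1, 0, 1, 0; 0, 0, 1, 1, 0, 0, 1, 1, 0; 1, 0, 0, 1, 1, 0, 0, 1, 0;
    1, 1, 0, 1, 0, 0, 1, 0, 0]

lemma four_dvd_weight_hammingGen (u : Fin 4 → ZMod 2) :
    4 ∣ ∑ i, ((hammingGen *ᵥ u) i).val := by
  revert u; decide

lemma four_dvd_weight_hammingGen' (u : Fin 4 → ZMod 2) :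
    4 ∣ ∑ i, ((hammingGen' *ᵥ u) i).val := by
  revert u; decide

lemma hammingDec_mul_hammingGen : hammingDec * hammingGen = 1 := by decide

lemma hammingDec'_mul_hammingGen' : hammingDec' * hammingGen' = 1 := by decide

lemma hammingDec_mul_hammingGen' : hammingDec * hammingGen' = 0 := by decide

lemma hammingGen_mul_hammingDec_add :
    hammingGen * hammingDec + hammingGen' * hammingDec' =
      1 + vecMulVec (Pi.single 8 1) (fun _ => 1) := by decide

lemma mulVec_injective_of_left_inverse {K : Matrix (Fin 4) (Fin 9) (ZMod 2)}
    {M : Matrix (Fin 9) (Fin 4) (ZMod 2)} (h : K * M = 1) : Function.Injective M.mulVec :=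
  Function.LeftInverse.injective (g := K.mulVec) fun u => by
    rw [mulVec_mulVec, h, one_mulVec]

lemma columnLattice_sup_eq : columnLattice hammingGen ⊔ columnLattice hammingGen' = A8lat := by
  refine le_antisymm (sup_le (columnLattice_le _) (columnLattice_le _)) fun a ha => ?_
  obtain ⟨x, hx, hxu⟩ := exists_mem_A8lat_modTwo_eq
    (sum_mulVec_eq_zero four_dvd_weight_hammingGen (hammingDec *ᵥ modTwo a))
  have hdec := congrArg (· *ᵥ modTwo a) hammingGen_mul_hammingDec_add
  have hone : (fun _ => 1) ⬝ᵥ modTwo a = 0 := by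
    simpa [dotProduct] using sum_modTwo_eq_zero ha
  simp only [add_mulVec, ← mulVec_mulVec, one_mulVec, vecMulVec_mulVec, hone] at hdec
  refine AddSubgroup.mem_sup.2 ⟨x, mem_columnLattice.2 ⟨hx, _, hxu.symm⟩, a - x,
    mem_columnLattice.2 ⟨sub_mem ha hx, hammingDec' *ᵥ modTwo a, ?_⟩, add_sub_cancel x a⟩
  rw [map_sub, hxu, eq_sub_iff_add_eq, add_comm, hdec]
  simp

lemma columnLattice_inf_eq : columnLattice hammingGen ⊓ columnLattice hammingGen' = twoA8lat := by
  refine le_antisymm ?_ (le_inf (twoA8lat_le_columnLattice _) (twoA8lat_le_columnLattice _))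
  rintro a ⟨⟨ha, u, hu⟩, -, w, hw⟩
  refine mem_twoA8lat_iff.2 ⟨ha, ?_⟩
  have h : hammingDec *ᵥ (hammingGen *ᵥ u) = hammingDec *ᵥ (hammingGen' *ᵥ w) :=
    congrArg hammingDec.mulVec (hu.trans hw.symm)
  rw [mulVec_mulVec, mulVec_mulVec, hammingDec_mul_hammingGen, hammingDec_mul_hammingGen',
    one_mulVec, zero_mulVec] at h
  rw [← hu, h, map_zero]

/-- There exist sublattices `2A₈ ≤ X, Y ≤ A₈` such that `X/2A₈` and `Y/2A₈` are
totally singular subspaces of dimension `4` (i.e. of cardinality `2⁴ = 16`) of the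
quadratic `𝔽₂`-space `A₈/2A₈` — where total singularity of `X/2A₈` means
`4 ∣ ⟨a,a⟩` for all `a ∈ X` — such that `4` is the maximal possible dimension of a
totally singular subspace, `X + Y = A₈`, and `A₈/2A₈` is the direct sum of `X/2A₈`
and `Y/2A₈` (equivalently `X ∩ Y = 2A₈`). -/
theorem exists_maximal_totally_singular_complementary_pair :
    ∃ X Y : AddSubgroup (Fin 9 → ℤ),
      twoA8lat ≤ X ∧ X ≤ A8lat ∧ twoA8lat ≤ Y ∧ Y ≤ A8lat ∧
      (∀ a ∈ X, (4 : ℤ) ∣ ∑ i, a i * a i) ∧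
      (∀ a ∈ Y, (4 : ℤ) ∣ ∑ i, a i * a i) ∧
      Nat.card (↥X ⧸ twoA8lat.addSubgroupOf X) = 16 ∧
      Nat.card (↥Y ⧸ twoA8lat.addSubgroupOf Y) = 16 ∧
      (∀ Z : AddSubgroup (Fin 9 → ℤ), twoA8lat ≤ Z → Z ≤ A8lat →
        (∀ a ∈ Z, (4 : ℤ) ∣ ∑ i, a i * a i) →
        Nat.card (↥Z ⧸ twoA8lat.addSubgroupOf Z) ≤ 16) ∧
      X ⊔ Y = A8lat ∧ X ⊓ Y = twoA8lat := by
  exact ⟨columnLattice hammingGen, columnLattice hammingGen',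
    twoA8lat_le_columnLattice _, columnLattice_le _,
    twoA8lat_le_columnLattice _, columnLattice_le _,
    fun _ => four_dvd_of_mem_columnLattice four_dvd_weight_hammingGen,
    fun _ => four_dvd_of_mem_columnLattice four_dvd_weight_hammingGen',
    card_quotient_columnLattice four_dvd_weight_hammingGen
      (mulVec_injective_of_left_inverse hammingDec_mul_hammingGen),
    card_quotient_columnLattice four_dvd_weight_hammingGen'
      (mulVec_injective_of_left_inverse hammingDec'_mul_hammingGen'),
    fun _ _ hZ h => card_quotient_le_of_four_dvd hZ h,
    columnLattice_sup_eq, columnLattice_inf_eq⟩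
end
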